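/- arXiv:1308.2691 — 10 statements merged into one kernel-verified Lean document; each statement's English description precedes it below -/
import Mathlib

section
/- Let G be a group and define two binary operations on G by x * y = [x,y] and x • y = [y,x], where [x,y] = x⁻¹y⁻¹xy. Then both * and • are associative on G if and only if [x,y,z]·[y,z,x] = 1 for all x, y, z ∈ G. -/
/-- The commutator `[x,y] = x⁻¹y⁻¹xy` as used in the paper. -/
def pcomm {G : Type*} [Group G] (x y : G) : G := x⁻¹ * y⁻¹ * x * y

/-- The operation `x * y = [x,y]`. -/
def cstar {G : Type*} [Group G] (x y : G) : G := pcomm x y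

/-- The operation `x • y = [y,x]`. -/
def cbull {G : Type*} [Group G] (x y : G) : G := pcomm y x

theorem pcomm_inv_swap {G : Type*} [Group G] (x y : G) : (pcomm x y)⁻¹ = pcomm y x := by
  simp [pcomm, mul_assoc]

theorem stmt_1 {G : Type*} [Group G] :
    ((∀ x y z : G, cstar (cstar x y) z = cstar x (cstar y z)) ∧
     (∀ x y z : G, cbull (cbull x y) z = cbull x (cbull y z))) ↔
    (∀ x y z : G, pcomm (pcomm x y) z * pcomm (pcomm y z) x = 1) := by
  simp only [cstar, cbull]
  constructor
  · rintro ⟨h, -⟩ x y z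
    rw [h, ← pcomm_inv_swap, inv_mul_cancel]
  · intro h
    have key : ∀ x y z : G, pcomm (pcomm x y) z = pcomm x (pcomm y z) := by
      intro x y z
      rw [← pcomm_inv_swap (pcomm y z) x]
      exact eq_inv_of_mul_eq_one_left (h x y z)
    exact ⟨key, fun x y z => (key z y x).symm⟩
end

section
/- In any group G, the law [[x,y],[x,z]] = 1 (for all x, y, z ∈ G) holds if and only if the law [[x,y], u⁻¹[x,z]u] = 1 (for all x, y, z, u ∈ G) holds. -/
theorem pcomm_eq_one_iff_commute {G : Type*} [Group G] (a b : G) :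
    pcomm a b = 1 ↔ Commute a b := by
  unfold pcomm
  constructor
  · intro h
    have h2 : a * b = b * a * (a⁻¹ * b⁻¹ * a * b) := by group
    rw [h, mul_one] at h2
    exact h2
  · intro h
    have h2 : a * b = b * a := h
    have h3 : a⁻¹ * b⁻¹ * a * b = a⁻¹ * b⁻¹ * (a * b) := by group
    rw [h3, h2]
    group

theorem stmt_3 {G : Type*} [Group G] :
    (∀ x y z : G, pcomm (pcomm x y) (pcomm x z) = 1) ↔
    (∀ x y z u : G, pcomm (pcomm x y) (u⁻¹ * pcomm x z * u) = 1) := by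
  constructor
  · intro h x y z u
    have key : u⁻¹ * pcomm x z * u = (pcomm x u)⁻¹ * pcomm x (z * u) := by
      unfold pcomm; group
    rw [key, pcomm_eq_one_iff_commute]
    exact ((pcomm_eq_one_iff_commute _ _).1 (h x y u)).inv_right.mul_right
      ((pcomm_eq_one_iff_commute _ _).1 (h x y (z * u)))
  · intro h x y z
    simpa using h x y z 1
end

section
/- If a group G satisfies the 3-metabelian law [[x,y],[x,z]] = 1 for all x, y, z ∈ G, then G satisfies the law [[[x,y],z],[x,u]] = 1 for all x, y, z, u ∈ G. -/
theorem stmt_4 {G : Type*} [Group G]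
    (h3M : ∀ x y z : G, pcomm (pcomm x y) (pcomm x z) = 1) :
    ∀ x y z u : G, pcomm (pcomm (pcomm x y) z) (pcomm x u) = 1 := by
  intro x y z u
  have h : ∀ a b : G, Commute (pcomm x a) (pcomm x b) := fun a b =>
    (pcomm_eq_one_iff_commute _ _).1 (h3M x a b)
  have e : pcomm (pcomm x y) z = (pcomm x y)⁻¹ * (pcomm x z)⁻¹ * pcomm x (y * z) := by
    simp only [pcomm]; group
  rw [pcomm_eq_one_iff_commute, e]
  exact ((h y u).inv_left.mul_left (h z u).inv_left).mul_left (h (y * z) u)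
end

section
/- If a group G satisfies the 3-metabelian law [[x,y],[x,z]] = 1 for all x, y, z ∈ G, then G satisfies the law [[x,y],[[x,u],v]] = 1 for all x, y, u, v ∈ G. -/
theorem stmt_5 {G : Type*} [Group G]
    (h3M : ∀ x y z : G, pcomm (pcomm x y) (pcomm x z) = 1) :
    ∀ x y u v : G, pcomm (pcomm x y) (pcomm (pcomm x u) v) = 1 := by
  intro x y u v
  have hc : ∀ a b : G, pcomm a b = 1 ↔ Commute a b := by
    intro a b
    have e : pcomm a b = (b * a)⁻¹ * (a * b) := by simp only [pcomm]; group
    rw [e, inv_mul_eq_one]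
    exact eq_comm
  have key : pcomm (pcomm x u) v = (pcomm x u)⁻¹ * (pcomm x v)⁻¹ * pcomm x (u * v) := by
    simp only [pcomm]; group
  rw [key, hc]
  have h : ∀ z, Commute (pcomm x y) (pcomm x z) := fun z => (hc _ _).1 (h3M x y z)
  exact ((h u).inv_right.mul_right (h v).inv_right).mul_right (h (u * v))
end

section
/- If a group G satisfies the 3-metabelian law [[x,y],[x,z]] = 1 for all x, y, z ∈ G, then G satisfies the law [[[x,y],z],[[x,u],v]] = 1 for all x, y, z, u, v ∈ G. -/
theorem pcomm_pcomm_eq {G : Type*} [Group G] (x y z : G) :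
    pcomm (pcomm x y) z = (pcomm x y)⁻¹ * (pcomm x z)⁻¹ * pcomm x (y * z) := by
  unfold pcomm; group

theorem stmt_6 {G : Type*} [Group G]
    (h3M : ∀ x y z : G, pcomm (pcomm x y) (pcomm x z) = 1) :
    ∀ x y z u v : G, pcomm (pcomm (pcomm x y) z) (pcomm (pcomm x u) v) = 1 := by
  intro x y z u v
  have h : ∀ a b : G, Commute (pcomm x a) (pcomm x b) := fun a b =>
    (pcomm_eq_one_iff_commute _ _).1 (h3M x a b)
  -- each `[[x,y],z]` is a product of commutators `[x,a]` and their inverses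
  have h1 : ∀ a : G, Commute (pcomm x a) (pcomm (pcomm x u) v) := fun a => by
    rw [pcomm_pcomm_eq]
    exact ((h a u).inv_right.mul_right (h a v).inv_right).mul_right (h a (u * v))
  rw [pcomm_eq_one_iff_commute, pcomm_pcomm_eq x y z]
  exact ((h1 y).inv_left.mul_left (h1 z).inv_left).mul_left (h1 (y * z))
end

section
/- If a group G satisfies the 3-metabelian law [[x,y],[x,z]] = 1 for all x, y, z ∈ G, then G satisfies the law [[w,x],[y,z]] · [[w,y],[x,z]] = 1 for all w, x, y, z ∈ G. -/
/-- The subgroup generated by all commutators `[x,y]` with fixed `x`. -/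
def commSub {G : Type*} [Group G] (x : G) : Subgroup G :=
  Subgroup.closure (Set.range (fun y => pcomm x y))

theorem mem_left {G : Type*} [Group G] (x y : G) : pcomm x y ∈ commSub x :=
  Subgroup.subset_closure ⟨y, rfl⟩

theorem mem_right {G : Type*} [Group G] (x y : G) : pcomm y x ∈ commSub x := by
  have h : pcomm y x = (pcomm x y)⁻¹ := by unfold pcomm; group
  rw [h]
  exact inv_mem (mem_left x y)

theorem mem_conj {G : Type*} [Group G] (x n g : G) (hn : n ∈ commSub x) :
    g⁻¹ * n * g ∈ commSub x := by
  unfold commSub at hn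
  induction hn using Subgroup.closure_induction with
  | mem n h =>
    obtain ⟨y, rfl⟩ := h
    have h : g⁻¹ * pcomm x y * g = (pcomm x g)⁻¹ * pcomm x (y * g) := by
      unfold pcomm; group
    change g⁻¹ * pcomm x y * g ∈ commSub x
    rw [h]
    exact mul_mem (inv_mem (mem_left _ _)) (mem_left _ _)
  | one => simp [one_mem]
  | mul a b _ _ ha hb =>
    have h : g⁻¹ * (a * b) * g = (g⁻¹ * a * g) * (g⁻¹ * b * g) := by group
    rw [h]; exact mul_mem ha hb
  | inv a _ ha =>
    have h : g⁻¹ * a⁻¹ * g = (g⁻¹ * a * g)⁻¹ := by group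
    rw [h]; exact inv_mem ha

theorem mem_comm_left {G : Type*} [Group G] (x n g : G) (hn : n ∈ commSub x) :
    pcomm n g ∈ commSub x := by
  have h : pcomm n g = n⁻¹ * (g⁻¹ * n * g) := by unfold pcomm; group
  rw [h]; exact mul_mem (inv_mem hn) (mem_conj x n g hn)

theorem pcomm_eq_one {G : Type*} [Group G] {a b : G} : pcomm a b = 1 ↔ a * b = b * a := by
  constructor
  · intro h
    calc a * b = b * a * pcomm a b := by unfold pcomm; group
      _ = b * a := by rw [h, mul_one]
  · intro h
    calc pcomm a b = a⁻¹ * b⁻¹ * (a * b) := by unfold pcomm; group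
      _ = 1 := by rw [h]; group

theorem commSub_comm {G : Type*} [Group G]
    (h3M : ∀ x y z : G, pcomm (pcomm x y) (pcomm x z) = 1) (x a b : G)
    (ha : a ∈ commSub x) (hb : b ∈ commSub x) : a * b = b * a := by
  have h1 : ∀ y, ∀ b ∈ commSub x, Commute (pcomm x y) b := by
    intro y b hb
    unfold commSub at hb
    induction hb using Subgroup.closure_induction with
    | mem n h => obtain ⟨z, rfl⟩ := h; exact pcomm_eq_one.1 (h3M x y z)
    | one => exact Commute.one_right _
    | mul a b _ _ ha hb => exact ha.mul_right hb
    | inv a _ ha => exact ha.inv_right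
  have h2 : Commute a b := by
    unfold commSub at ha
    induction ha using Subgroup.closure_induction with
    | mem n h => obtain ⟨z, rfl⟩ := h; exact h1 z b hb
    | one => exact Commute.one_left _
    | mul a b _ _ ha hb => exact ha.mul_left hb
    | inv a _ ha => exact ha.inv_left
  exact h2

theorem key_algebra {G : Type*} [Group G] (a b c d : G)
    (hbb : b * (d⁻¹ * b * d) = (d⁻¹ * b * d) * b)
    (hcb : c * (d⁻¹ * b * d) = (d⁻¹ * b * d) * c)
    (had : a * d = d * a) (hcd : c * d = d * c)
    (h : (a * b) * (c * d) = (c * d) * (a * b)) : pcomm b d * pcomm a c = 1 := by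
  have h1 : a * c * (d⁻¹ * b * d) = c * a * b := by
    calc a * c * (d⁻¹ * b * d) = a * (d⁻¹ * b * d * c) := by rw [mul_assoc, hcb]
      _ = d⁻¹ * (d * a) * d⁻¹ * b * (d * c) := by group
      _ = d⁻¹ * ((a * b) * (c * d)) := by rw [← had, ← hcd]; group
      _ = d⁻¹ * (d * c) * (a * b) := by rw [h, hcd]; group
      _ = c * a * b := by group
  have h2 : a * c = c * a * b * (d⁻¹ * b * d)⁻¹ := by rw [← h1]; group
  calc pcomm b d * pcomm a c = b⁻¹ * (d⁻¹ * b * d) * (a⁻¹ * c⁻¹ * (a * c)) := by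
        unfold pcomm; group
    _ = b⁻¹ * ((d⁻¹ * b * d) * b) * (d⁻¹ * b * d)⁻¹ := by rw [h2]; group
    _ = 1 := by rw [← hbb]; group

/-- The exchange law, up to conjugation. -/
theorem swap_law {G : Type*} [Group G]
    (h3M : ∀ x y z : G, pcomm (pcomm x y) (pcomm x z) = 1) (w x y z : G) :
    pcomm (pcomm w x) (pcomm y z) *
      pcomm (y * pcomm w y * y⁻¹) (y⁻¹ * pcomm x z * y) = 1 := by
  have cj : ∀ u n : G, n ∈ commSub u → y * n * y⁻¹ ∈ commSub u := by
    intro u n hn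
    simpa using mem_conj u n y⁻¹ hn
  have e : (y * pcomm w y * y⁻¹) * pcomm w x = y * pcomm w (x * y) * y⁻¹ := by
    unfold pcomm; group
  have e' : (y⁻¹ * pcomm x z * y) * pcomm y z = pcomm (x * y) z := by
    unfold pcomm; group
  apply key_algebra
  · exact commSub_comm h3M x _ _ (mem_right _ _) (mem_conj _ _ _ (mem_right _ _))
  · exact commSub_comm h3M x _ _ (mem_conj _ _ _ (mem_left _ _)) (mem_conj _ _ _ (mem_right _ _))
  · exact commSub_comm h3M y _ _ (cj _ _ (mem_right _ _)) (mem_left _ _)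
  · exact commSub_comm h3M z _ _ (mem_conj _ _ _ (mem_right _ _)) (mem_right _ _)
  · rw [e, e']
    exact commSub_comm h3M (x * y) _ _ (cj _ _ (mem_right _ _)) (mem_left _ _)

theorem stmt_7 {G : Type*} [Group G]
    (h3M : ∀ x y z : G, pcomm (pcomm x y) (pcomm x z) = 1) :
    ∀ w x y z : G, pcomm (pcomm w x) (pcomm y z) * pcomm (pcomm w y) (pcomm x z) = 1 := by
  intro w x y z
  have hs := swap_law h3M w x y z
  have inv_mem_conj : ∀ n g : G, n ∈ commSub y → g * n * g⁻¹ ∈ commSub y := by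
    intro n g hn
    simpa using mem_conj y n g⁻¹ hn
  obtain ⟨A, hA⟩ : ∃ A, A = pcomm w y := ⟨_, rfl⟩
  obtain ⟨B, hB⟩ : ∃ B, B = pcomm x z := ⟨_, rfl⟩
  have hAy : A ∈ commSub y := hA ▸ mem_right y w
  -- `[[A, y⁻¹], B] = 1`
  have h1 : pcomm (pcomm A y⁻¹) B = 1 := by
    have h := swap_law h3M A y⁻¹ x z
    have hz : pcomm y⁻¹ z ∈ commSub y := by
      have : pcomm y⁻¹ z = y * (pcomm y z)⁻¹ * y⁻¹ := by unfold pcomm; group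
      rw [this]
      exact inv_mem_conj _ _ (inv_mem (mem_left _ _))
    have h' : pcomm (x * pcomm A x * x⁻¹) (x⁻¹ * pcomm y⁻¹ z * x) = 1 :=
      pcomm_eq_one.2 (commSub_comm h3M y _ _
        (inv_mem_conj _ _ (mem_comm_left _ _ _ hAy)) (mem_conj _ _ _ hz))
    rwa [h', mul_one, ← hB] at h
  rw [← hA, ← hB] at hs ⊢
  -- replace the conjugates
  have h2 : pcomm (y * A * y⁻¹) (y⁻¹ * B * y) = pcomm (y * A * y⁻¹) B := by
    have e : pcomm (y * A * y⁻¹) (y⁻¹ * B * y) =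
        pcomm (y * A * y⁻¹) (pcomm B y) *
          ((pcomm B y)⁻¹ * (pcomm (y * A * y⁻¹) B * pcomm B y)) := by
      unfold pcomm; group
    rw [e, pcomm_eq_one.2 (commSub_comm h3M y _ _ (inv_mem_conj _ _ hAy) (mem_right y B)),
      commSub_comm h3M y _ _ (mem_comm_left _ _ B (inv_mem_conj _ y hAy)) (mem_right y B)]
    group
  have h3 : pcomm (y * A * y⁻¹) B = pcomm A B := by
    have e : pcomm (y * A * y⁻¹) B =
        (pcomm A y⁻¹)⁻¹ * (pcomm A B * pcomm A y⁻¹) * pcomm (pcomm A y⁻¹) B := by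
      unfold pcomm; group
    rw [e, h1, commSub_comm h3M y _ _ (mem_comm_left _ _ B hAy) (mem_comm_left _ _ y⁻¹ hAy)]
    group
  rwa [h2, h3] at hs
end

section
/- A group G satisfies the commutator interchange law [[w,x],[y,z]] = [[w,y],[x,z]] for all w, x, y, z ∈ G if and only if G satisfies both the 3-metabelian law [[x,y],[x,z]] = 1 for all x, y, z ∈ G and the law [[w,x],[y,z]]² = 1 for all w, x, y, z ∈ G. -/
/-- In a 3-metabelian group each element `x` lies in a commutation scheme: there are
abelian normal subgroups `S x` containing all `[x,z]`. -/
theorem exists_S {G : Type*} [Group G]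
    (h : ∀ x y z : G, pcomm (pcomm x y) (pcomm x z) = 1) :
    ∃ S : G → Subgroup G, (∀ x, ∀ a ∈ S x, ∀ b ∈ S x, a * b = b * a) ∧
      (∀ x, ∀ a ∈ S x, ∀ g, pcomm a g ∈ S x) ∧ (∀ x, ∀ a ∈ S x, ∀ g, pcomm g a ∈ S x) ∧
      (∀ x y, pcomm x y ∈ S x) ∧ (∀ x y, pcomm x y ∈ S y) := by
  have hmem : ∀ x y : G, pcomm x y ∈ Subgroup.closure (Set.range (pcomm x)) :=
    fun x y => Subgroup.subset_closure ⟨y, rfl⟩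
  have hconj : ∀ x : G, ∀ a ∈ Subgroup.closure (Set.range (pcomm x)), ∀ g : G,
      g⁻¹ * a * g ∈ Subgroup.closure (Set.range (pcomm x)) := by
    intro x a ha g
    induction ha using Subgroup.closure_induction with
    | mem a ha =>
      obtain ⟨z, rfl⟩ := ha
      have e : g⁻¹ * pcomm x z * g = (pcomm x g)⁻¹ * pcomm x (z * g) := by
        simp only [pcomm]; group
      rw [e]
      exact mul_mem (inv_mem (hmem _ _)) (hmem _ _)
    | one => simp
    | mul a b _ _ ha hb =>
      have e : g⁻¹ * (a * b) * g = (g⁻¹ * a * g) * (g⁻¹ * b * g) := by group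
      rw [e]; exact mul_mem ha hb
    | inv a _ ha =>
      have e : g⁻¹ * a⁻¹ * g = (g⁻¹ * a * g)⁻¹ := by group
      rw [e]; exact inv_mem ha
  have hc1 : ∀ x : G, ∀ a ∈ Subgroup.closure (Set.range (pcomm x)), ∀ g : G,
      pcomm a g ∈ Subgroup.closure (Set.range (pcomm x)) := by
    intro x a ha g
    have e : pcomm a g = a⁻¹ * (g⁻¹ * a * g) := by simp only [pcomm]; group
    rw [e]; exact mul_mem (inv_mem ha) (hconj x a ha g)
  refine ⟨fun x => Subgroup.closure (Set.range (pcomm x)), ?_, hc1, ?_, hmem, ?_⟩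
  · intro x a ha b hb
    induction ha, hb using Subgroup.closure_induction₂ with
    | mem a b ha hb =>
      obtain ⟨y, rfl⟩ := ha
      obtain ⟨z, rfl⟩ := hb
      have := h x y z
      generalize pcomm x y = a at *
      generalize pcomm x z = b at *
      have e : a * b = b * a * pcomm a b := by simp only [pcomm]; group
      rw [e, this, mul_one]
    | one_left b _ => simp
    | one_right b _ => simp
    | mul_left a b c _ _ _ h1 h2 => exact (Commute.mul_left (a := a) (b := b) h1 h2)
    | mul_right a b c _ _ _ h1 h2 => exact (Commute.mul_right (a := c) (b := a) (c := b) h1 h2)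
    | inv_left a b _ _ h1 => exact (Commute.inv_left (a := a) (b := b) h1)
    | inv_right a b _ _ h1 => exact (Commute.inv_right (a := a) (b := b) h1)
  · intro x a ha g
    rw [← pcomm_inv_swap]; exact inv_mem (hc1 x a ha g)
  · intro x y
    rw [← pcomm_inv_swap]; exact inv_mem (hmem y x)

/-- `[a⁻¹,b] = [a,b]⁻¹` when `[a,b]` commutes with `a`. -/
theorem pcomm_inv_left' {G : Type*} [Group G] (a b : G)
    (h : a * pcomm a b = pcomm a b * a) : pcomm a⁻¹ b = (pcomm a b)⁻¹ := by
  have e : pcomm a⁻¹ b = a * (pcomm a b)⁻¹ * a⁻¹ := by simp only [pcomm]; group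
  rw [e, (Commute.inv_right (a := a) (b := pcomm a b) h).eq]; group

theorem pcomm_inv_right' {G : Type*} [Group G] (a b : G)
    (h : b * pcomm a b = pcomm a b * b) : pcomm a b⁻¹ = (pcomm a b)⁻¹ := by
  have e : pcomm a b⁻¹ = b * (pcomm a b)⁻¹ * b⁻¹ := by simp only [pcomm]; group
  rw [e, (Commute.inv_right (a := b) (b := pcomm a b) h).eq]; group

theorem pcomm_spec {G : Type*} [Group G] (a b : G) : a * b = b * a * pcomm a b := by
  simp only [pcomm]; group

theorem swap13 {G : Type*} [Group G]
    (h : ∀ x y z : G, pcomm (pcomm x y) (pcomm x z) = 1) (x y w z : G) :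
    pcomm (pcomm x y) (pcomm w z) * pcomm (pcomm w y) (pcomm x z) = 1 := by
  obtain ⟨S, hab, hl, hr, h1, h2⟩ := exists_S h
  -- replacing `a` by its conjugate `a * [a,w]`
  have key1 : pcomm (pcomm x y * pcomm (pcomm x y) w) (pcomm w z)
      = pcomm (pcomm x y) (pcomm w z) := by
    have c1 := hab w _ (h2 (pcomm x y) w) _ (h1 w z)
    have c2 := hab x _ (hl x _ (h1 x y) w) _ (hl x _ (h1 x y) (pcomm w z))
    generalize pcomm (pcomm x y) w = t at *
    generalize pcomm x y = a at *
    generalize pcomm w z = d at *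
    have e : pcomm (a * t) d = t⁻¹ * (pcomm a d * (d⁻¹ * (t * d))) := by
      simp only [pcomm]; group
    rw [e, c1, inv_mul_cancel_left, ← c2, inv_mul_cancel_left]
  have key2 : pcomm (pcomm w y) (pcomm x z * pcomm (pcomm x z) w)
      = pcomm (pcomm w y) (pcomm x z) := by
    have c1 := hab w _ (h2 (pcomm x z) w) _ (h1 w y)
    have c2 := hab x _ (hl x _ (h1 x z) w) _ (hr x _ (h1 x z) (pcomm w y))
    generalize pcomm (pcomm x z) w = t at *
    generalize pcomm x z = c at *
    generalize pcomm w y = b at *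
    have e : pcomm b (c * t) = b⁻¹ * t⁻¹ * (b * t) * (t⁻¹ * (pcomm b c * t)) := by
      simp only [pcomm]; group
    rw [e, ← c1, ← c2]; group
  rw [← key1, ← key2]
  have hA : pcomm (x * w) y = (pcomm x y * pcomm (pcomm x y) w) * pcomm w y := by
    simp only [pcomm]; group
  have hC : pcomm (x * w) z = (pcomm x z * pcomm (pcomm x z) w) * pcomm w z := by
    simp only [pcomm]; group
  have hAx : pcomm x y * pcomm (pcomm x y) w ∈ S x := mul_mem (h1 _ _) (hl _ _ (h1 _ _) _)
  have hAy : pcomm x y * pcomm (pcomm x y) w ∈ S y := mul_mem (h2 _ _) (hl _ _ (h2 _ _) _)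
  have hCx : pcomm x z * pcomm (pcomm x z) w ∈ S x := mul_mem (h1 _ _) (hl _ _ (h1 _ _) _)
  have hCz : pcomm x z * pcomm (pcomm x z) w ∈ S z := mul_mem (h2 _ _) (hl _ _ (h2 _ _) _)
  have hBw := h1 w y
  have hBy := h2 w y
  have hDw := h1 w z
  have hDz := h2 w z
  have hmain : pcomm (x * w) y * pcomm (x * w) z = pcomm (x * w) z * pcomm (x * w) y :=
    hab _ _ (h1 _ _) _ (h1 _ _)
  rw [hA, hC] at hmain
  generalize pcomm x y * pcomm (pcomm x y) w = A at *
  generalize pcomm x z * pcomm (pcomm x z) w = C at *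
  generalize pcomm w y = B at *
  generalize pcomm w z = D at *
  have s1 : B * C = C * B * pcomm B C := pcomm_spec _ _
  have s2 : A * D = D * A * pcomm A D := pcomm_spec _ _
  have e1 : A * C = C * A := hab x _ hAx _ hCx
  have e2 : B * D = D * B := hab w _ hBw _ hDw
  have e3 : pcomm B C * D = D * pcomm B C := hab w _ (hl w _ hBw _) _ hDw
  have e4 : pcomm A D * B = B * pcomm A D := hab y _ (hl y _ hAy _) _ hBy
  have e : A * B * (C * D) = C * D * (A * B) * (pcomm A D * pcomm B C) := by
    calc A * B * (C * D) = A * (B * C) * D := by group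
      _ = (A * C) * B * (pcomm B C * D) := by rw [s1]; group
      _ = C * A * (B * D) * pcomm B C := by rw [e1, e3]; group
      _ = C * (A * D) * B * pcomm B C := by rw [e2]; group
      _ = C * D * A * (pcomm A D * B) * pcomm B C := by rw [s2]; group
      _ = _ := by rw [e4]; group
  rw [e] at hmain
  exact mul_eq_left.mp hmain

theorem stmt_8 {G : Type*} [Group G] :
    (∀ w x y z : G, pcomm (pcomm w x) (pcomm y z) = pcomm (pcomm w y) (pcomm x z)) ↔
    ((∀ x y z : G, pcomm (pcomm x y) (pcomm x z) = 1) ∧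
     (∀ w x y z : G, (pcomm (pcomm w x) (pcomm y z)) ^ 2 = 1)) := by
  constructor
  · intro H
    have h : ∀ x y z : G, pcomm (pcomm x y) (pcomm x z) = 1 := by
      intro x y z
      rw [← H x x y z]; simp only [pcomm]; group
    refine ⟨h, ?_⟩
    obtain ⟨S, hab, hl, hr, h1, h2⟩ := exists_S h
    intro w x y z
    rw [H w x y z]
    have e : (pcomm (pcomm w y) (pcomm x z))⁻¹ = pcomm (pcomm w y)⁻¹ (pcomm x z)⁻¹ := by
      rw [← H w x y z, pcomm_inv_swap, H, pcomm_inv_swap, pcomm_inv_swap]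
    have c1 := hab w _ (h1 w y) _ (hl w _ (h1 w y) (pcomm x z))
    have c2 := hab x _ (h1 x z) _ (hr x _ (h1 x z) (pcomm w y))
    have c3 := hab x _ (h1 x z) _ (hr x _ (h1 x z) (pcomm w y)⁻¹)
    rw [pcomm_inv_right' _ _ c3, pcomm_inv_left' _ _ c1, inv_inv] at e
    rw [pow_two]
    nth_rewrite 1 [← e]
    exact inv_mul_cancel _
  · rintro ⟨h, hsq⟩
    obtain ⟨S, hab, hl, hr, h1, h2⟩ := exists_S h
    have hinv : ∀ w x y z : G, (pcomm (pcomm w x) (pcomm y z))⁻¹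
        = pcomm (pcomm w x) (pcomm y z) := by
      intro w x y z
      have := hsq w x y z
      rw [pow_two] at this
      exact inv_eq_of_mul_eq_one_left this
    have s12 : ∀ w x y z : G, pcomm (pcomm w x) (pcomm y z)
        = pcomm (pcomm x w) (pcomm y z) := by
      intro w x y z
      rw [← pcomm_inv_swap w x, pcomm_inv_left' _ _
        (hab w _ (h1 w x) _ (hl w _ (h1 w x) (pcomm y z))), hinv]
    have s13 : ∀ w x y z : G, pcomm (pcomm w x) (pcomm y z)
        = pcomm (pcomm y x) (pcomm w z) := by
      intro w x y z
      rw [eq_inv_of_mul_eq_one_left (swap13 h w x y z), hinv]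
    intro w x y z
    rw [s12 w x, s13 x w, s12 y w]
end

section
/- Let G be a group with operations x * y = [x,y] and x • y = [y,x]. Then (G, *, •) is a double semigroup (i.e., the interchange law (w * x) • (y * z) = (w • y) * (x • z) holds for all w, x, y, z ∈ G and both operations are associative) if and only if G is nilpotent of class at most 2, that is, [[x,y],z] = 1 for all x, y, z ∈ G. -/
theorem pcomm_swap {G : Type*} [Group G] (x y : G) : pcomm y x = (pcomm x y)⁻¹ := by
  simp [pcomm, mul_assoc]

theorem pcomm_one_iff {G : Type*} [Group G] (x y : G) : pcomm x y = 1 ↔ x * y = y * x := by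
  have : pcomm x y = (y * x)⁻¹ * (x * y) := by simp [pcomm, mul_assoc]
  rw [this, inv_mul_eq_one, eq_comm]

theorem hall_witt {G : Type*} [Group G] (x y z : G) :
    (y⁻¹ * pcomm (pcomm x y⁻¹) z * y) * (z⁻¹ * pcomm (pcomm y z⁻¹) x * z) *
      (x⁻¹ * pcomm (pcomm z x⁻¹) y * x) = 1 := by
  simp [pcomm, mul_assoc]

theorem assoc_class_two {G : Type*} [Group G]
    (h : ∀ x y z : G, pcomm (pcomm x y) z = pcomm x (pcomm y z)) (x y z : G) :
    pcomm (pcomm x y) z = 1 := by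
  have one_r : ∀ a : G, pcomm a 1 = 1 := fun a => by simp [pcomm]
  have self : ∀ a : G, pcomm a a = 1 := fun a => by simp [pcomm]
  have E : ∀ a b : G, pcomm (pcomm a b) b = 1 := fun a b => by rw [h, self, one_r]
  have inv_r : ∀ a b : G, pcomm a b⁻¹ = pcomm b a := fun a b => by
    have h1 := (pcomm_one_iff _ _).1 (E a b)
    have h2 : pcomm a b⁻¹ = b * (pcomm a b)⁻¹ * b⁻¹ := by simp [pcomm, mul_assoc]
    have h3 : Commute (pcomm a b) b := h1
    rw [h2, pcomm_swap a b, ← h3.inv_left.eq, mul_inv_cancel_right]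
  have sw : ∀ a b c : G, pcomm (pcomm a c) b = (pcomm (pcomm a b) c)⁻¹ := fun a b c => by
    rw [h, pcomm_swap b c, inv_r, pcomm_swap, ← h]
  have sw1 : ∀ a b c : G, pcomm (pcomm b a) c = (pcomm (pcomm a b) c)⁻¹ := fun a b c => by
    rw [pcomm_swap a b, pcomm_swap c, inv_r, pcomm_swap c]
  have cyc : ∀ a b c : G, pcomm (pcomm b c) a = pcomm (pcomm a b) c := fun a b c => by
    rw [sw b a c, sw1 a b c, inv_inv]
  have sq : ∀ a b c : G, (pcomm (pcomm a b) c)⁻¹ = pcomm (pcomm a b) c := fun a b c => by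
    rw [← cyc a b c, ← pcomm_swap, ← h]; exact (cyc a b c).symm
  have conj : ∀ a b c : G, c⁻¹ * pcomm (pcomm a b) c * c = pcomm (pcomm a b) c := fun a b c => by
    have h1 := (pcomm_one_iff _ _).1 (E (pcomm a b) c)
    rw [mul_assoc, h1, inv_mul_cancel_left]
  have hw := hall_witt x y z
  rw [inv_r, inv_r, inv_r, sw1 x y z, sw1 y z x, sw1 z x y, sq, sq, sq] at hw
  have c1 := conj z x y
  have c2 := conj x y z
  have c3 := conj y z x
  have e1 : pcomm (pcomm z x) y = pcomm (pcomm x y) z := (cyc z x y).symm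
  have e2 : pcomm (pcomm y z) x = pcomm (pcomm x y) z := cyc x y z
  rw [e1] at c1
  rw [e2] at c3
  rw [e1, e2, c1, c2, c3] at hw
  have s := sq x y z
  rw [inv_eq_iff_mul_eq_one] at s
  rwa [s, one_mul] at hw

theorem stmt_10 {G : Type*} [Group G] :
    ((∀ w x y z : G, cbull (cstar w x) (cstar y z) = cstar (cbull w y) (cbull x z)) ∧
     (∀ x y z : G, cstar (cstar x y) z = cstar x (cstar y z)) ∧
     (∀ x y z : G, cbull (cbull x y) z = cbull x (cbull y z))) ↔
    (∀ x y z : G, pcomm (pcomm x y) z = 1) := by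
  simp only [cstar, cbull]
  constructor
  · rintro ⟨-, h, -⟩
    exact assoc_class_two h
  · intro h
    have h' : ∀ x y z : G, pcomm z (pcomm x y) = 1 := fun x y z => by
      rw [pcomm_swap, h, inv_one]
    simp [h, h']
end

section
/- In the dihedral group D₃ of order 6 (with presentation ⟨a, b; a³ = 1, b² = 1, ba = a²b⟩), the commutator interchange law [[w,x],[y,z]] = [[w,y],[x,z]] holds for all w, x, y, z, and there exist elements x, y with [x,y] ≠ [y,x]; hence the operations x * y = [x,y] and x • y = [y,x] make D₃ into a proper double magma. -/
/-- Every commutator in a dihedral group is a rotation. -/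
theorem pcomm_rot (x y : DihedralGroup 3) : ∃ k, pcomm x y = DihedralGroup.r k := by
  rcases x with i | i <;> rcases y with j | j <;> exact ⟨_, rfl⟩

/-- Commutators in the dihedral group commute with each other. -/
theorem pcomm_pcomm (w x y z : DihedralGroup 3) : pcomm (pcomm w x) (pcomm y z) = 1 := by
  obtain ⟨i, hi⟩ := pcomm_rot w x
  obtain ⟨j, hj⟩ := pcomm_rot y z
  rw [hi, hj]
  simp [pcomm]

/-- A rotation and a reflection witness that the two operations differ. -/
theorem pcomm_ne : pcomm (DihedralGroup.r 1 : DihedralGroup 3) (DihedralGroup.sr 0) ≠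
    pcomm (DihedralGroup.sr 0) (DihedralGroup.r 1) := by
  decide

theorem stmt_14 :
    (∀ w x y z : DihedralGroup 3,
      pcomm (pcomm w x) (pcomm y z) = pcomm (pcomm w y) (pcomm x z)) ∧
    (∃ x y : DihedralGroup 3, pcomm x y ≠ pcomm y x) ∧
    -- hence `(D₃, *, •)` is a proper double magma:
    (∀ w x y z : DihedralGroup 3,
      cbull (cstar w x) (cstar y z) = cstar (cbull w y) (cbull x z)) ∧
    (cstar : DihedralGroup 3 → DihedralGroup 3 → DihedralGroup 3) ≠ cbull := by
  refine ⟨fun w x y z => ?_, ⟨_, _, pcomm_ne⟩, fun w x y z => ?_, fun h => ?_⟩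
  · rw [pcomm_pcomm, pcomm_pcomm]
  · unfold cbull cstar
    rw [pcomm_pcomm, pcomm_pcomm]
  · exact pcomm_ne (congrFun (congrFun h _) _)
end

section
/- Let R be an associative (not necessarily commutative) ring, and for x, y ∈ R write ⟨x,y⟩ = xy − yx for the ring (Lie) commutator. Then the ring commutator interchange law ⟨⟨w,x⟩,⟨y,z⟩⟩ = ⟨⟨w,y⟩,⟨x,z⟩⟩ holds for all w, x, y, z ∈ R if and only if R satisfies both ⟨⟨x,y⟩,⟨x,z⟩⟩ = 0 for all x, y, z ∈ R and 2·⟨⟨w,x⟩,⟨y,z⟩⟩ = 0 for all w, x, y, z ∈ R. -/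
/-- The ring (Lie) commutator `⟨x,y⟩ = xy - yx`. -/
def rcomm {R : Type*} [Ring R] (x y : R) : R := x * y - y * x

theorem rcomm_anti_left {R : Type*} [Ring R] (a b c : R) :
    rcomm (rcomm a b) c = - rcomm (rcomm b a) c := by
  unfold rcomm; noncomm_ring

theorem rcomm_anti_right {R : Type*} [Ring R] (a b c : R) :
    rcomm c (rcomm a b) = - rcomm c (rcomm b a) := by
  unfold rcomm; noncomm_ring

theorem rcomm_lin {R : Type*} [Ring R] (w x y z : R) :
    rcomm (rcomm (w + x) y) (rcomm (w + x) z) =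
      rcomm (rcomm w y) (rcomm w z) + rcomm (rcomm x y) (rcomm x z)
      + (rcomm (rcomm w y) (rcomm x z) + rcomm (rcomm x y) (rcomm w z)) := by
  unfold rcomm; noncomm_ring

theorem stmt_16 {R : Type*} [Ring R] :
    (∀ w x y z : R, rcomm (rcomm w x) (rcomm y z) = rcomm (rcomm w y) (rcomm x z)) ↔
    ((∀ x y z : R, rcomm (rcomm x y) (rcomm x z) = 0) ∧
     (∀ w x y z : R, 2 * rcomm (rcomm w x) (rcomm y z) = 0)) := by
  constructor
  · intro h
    refine ⟨fun x y z => ?_, fun w x y z => ?_⟩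
    · rw [← h x x y z]; simp [rcomm]
    · have e : rcomm (rcomm w x) (rcomm y z) = - rcomm (rcomm w x) (rcomm y z) := by
        calc rcomm (rcomm w x) (rcomm y z)
            = - rcomm (rcomm w x) (rcomm z y) := rcomm_anti_right _ _ _
          _ = - rcomm (rcomm w z) (rcomm x y) := by rw [h w x z y]
          _ = rcomm (rcomm w z) (rcomm y x) := by rw [rcomm_anti_right x y, neg_neg]
          _ = rcomm (rcomm w y) (rcomm z x) := h _ _ _ _
          _ = - rcomm (rcomm w y) (rcomm x z) := rcomm_anti_right _ _ _
          _ = - rcomm (rcomm w x) (rcomm y z) := by rw [h w x y z]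
      rw [two_mul]
      exact add_eq_zero_iff_eq_neg.mpr e
  · rintro ⟨h1, h2⟩ w x y z
    have l := rcomm_lin x y w z
    rw [h1, h1, h1, zero_add, zero_add] at l
    have t := h2 w y x z
    rw [two_mul] at t
    rw [rcomm_anti_left w x, eq_neg_of_add_eq_zero_left l.symm, neg_neg,
      rcomm_anti_left y w]
    exact (eq_neg_of_add_eq_zero_left t).symm
end
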